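/- Case (iv) of the proof of Theorem 1: In the GCQC setup, for levels 1 ≤ j < i ≤ m, any u ∈ S_{A_i}^⊥ ∖ S_{A_i}, and any v ∈ S_{A_j}, the sum φ_i(u) + φ_j(v) has symplectic weight at least d_j · max{D_i, bwt(v)}. In particular, if A_j is nondegenerate (every nonzero element of S_{A_j} has block weight at least D_j) and v ≠ 0, then swt(φ_i(u) + φ_j(v)) ≥ d_j D_j; and in all cases swt(φ_i(u) + φ_j(v)) ≥ d_j D_i. -/

import Mathlib

open Finset

/-- Pauli operators (up to phase) on `n` qubits, as symplectic vectors. -/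
abbrev Pauli (n : ℕ) := Fin n → (ZMod 2) × (ZMod 2)

/-- The outer space `W = (𝔽₂^r × 𝔽₂^r)^N`. -/
abbrev Outer (r N : ℕ) := Fin N → (Fin r → ZMod 2) × (Fin r → ZMod 2)

/-- `N` blocks of `n` qubits each. -/
abbrev PauliB (n N : ℕ) := Fin N → Pauli n

/-- Elementary symplectic form on one qubit. -/
def B0 : LinearMap.BilinForm (ZMod 2) ((ZMod 2) × (ZMod 2)) :=
  LinearMap.mk₂ (ZMod 2) (fun u v => u.1 * v.2 + v.1 * u.2)
    (fun a b v => by simp; ring)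
    (fun c a v => by simp; ring)
    (fun a b v => by simp; ring)
    (fun c a v => by simp; ring)

/-- Sum of a bilinear form over `N` coordinates. -/
def sumForm {M : Type*} [AddCommGroup M] [Module (ZMod 2) M] (N : ℕ)
    (B : LinearMap.BilinForm (ZMod 2) M) :
    LinearMap.BilinForm (ZMod 2) (Fin N → M) :=
  LinearMap.mk₂ (ZMod 2) (fun u v => ∑ j, B (u j) (v j))
    (fun a b v => by simp [Finset.sum_add_distrib])
    (fun c a v => by simp [Finset.mul_sum])
    (fun a b v => by simp [Finset.sum_add_distrib])
    (fun c a v => by simp [Finset.mul_sum])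

/-- Symplectic form on `r`-qubit blocks written as pairs of binary `r`-vectors. -/
def pairForm (r : ℕ) : LinearMap.BilinForm (ZMod 2) ((Fin r → ZMod 2) × (Fin r → ZMod 2)) :=
  LinearMap.mk₂ (ZMod 2) (fun u v => ∑ ℓ, (u.1 ℓ * v.2 ℓ + v.1 ℓ * u.2 ℓ))
    (fun a b v => by rw [← Finset.sum_add_distrib]; refine Finset.sum_congr rfl fun ℓ _ => by simp; ring)
    (fun c a v => by rw [smul_eq_mul, Finset.mul_sum]; refine Finset.sum_congr rfl fun ℓ _ => by simp; ring)
    (fun a b v => by rw [← Finset.sum_add_distrib]; refine Finset.sum_congr rfl fun ℓ _ => by simp; ring)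
    (fun c a v => by rw [smul_eq_mul, Finset.mul_sum]; refine Finset.sum_congr rfl fun ℓ _ => by simp; ring)

/-- Symplectic form on `Pauli n`. -/
def symplF (n : ℕ) : LinearMap.BilinForm (ZMod 2) (Pauli n) := sumForm n B0

/-- Symplectic form on `N` blocks of `n` qubits. -/
def symplFB (n N : ℕ) : LinearMap.BilinForm (ZMod 2) (PauliB n N) := sumForm N (symplF n)

/-- Symplectic form on the outer space `W_i`. -/
def symplFO (r N : ℕ) : LinearMap.BilinForm (ZMod 2) (Outer r N) := sumForm N (pairForm r)

/-- Orthogonal complement of a subspace w.r.t. a bilinear form. -/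
def perp {M : Type*} [AddCommGroup M] [Module (ZMod 2) M]
    (B : LinearMap.BilinForm (ZMod 2) M) (S : Submodule (ZMod 2) M) :
    Submodule (ZMod 2) M where
  carrier := {v | ∀ s ∈ S, B s v = 0}
  add_mem' := fun hu hv s hs => by
    rw [map_add, hu s hs, hv s hs, add_zero]
  zero_mem' := fun s hs => by simp
  smul_mem' := fun c v hv s hs => by
    rw [map_smul, hv s hs, smul_zero]

/-- Generic weight: number of nonzero coordinates. -/
def wgt {N : ℕ} {M : Type*} [Zero M] [DecidableEq M] (v : Fin N → M) : ℕ :=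
  (Finset.univ.filter fun j => v j ≠ 0).card

/-- Symplectic weight on `N` blocks of `n` qubits: number of nonzero qubit positions. -/
def swtB {n N : ℕ} (v : PauliB n N) : ℕ := ∑ j, wgt (v j)

/-- Stabilizer of the subcode `B_i`: `S` together with the logical `z`'s of index `< kk`. -/
def Sstab (n : ℕ) (S : Submodule (ZMod 2) (Pauli n)) (z : ℕ → Pauli n) (kk : ℕ) :
    Submodule (ZMod 2) (Pauli n) :=
  S ⊔ Submodule.span (ZMod 2) (z '' Set.Iio kk)

/-- Span of the logical operators `x_t, z_t` with `a ≤ t < b` (0-based indexing). -/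
def Lspan (n : ℕ) (x z : ℕ → Pauli n) (a b : ℕ) : Submodule (ZMod 2) (Pauli n) :=
  Submodule.span (ZMod 2) ((x '' Set.Ico a b) ∪ (z '' Set.Ico a b))

/-- The block-wise inner stabilizer `S_I`. -/
def SI (n N : ℕ) (S : Submodule (ZMod 2) (Pauli n)) : Submodule (ZMod 2) (PauliB n N) :=
  Submodule.pi (Set.univ : Set (Fin N)) (fun _ => S)

/-- The replacement map `φ` with offset `off`, sending the `ℓ`-th binary coordinates of each
block to the logical operators `x (off+ℓ)`, `z (off+ℓ)` of the inner code. -/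
def phi (n N : ℕ) (x z : ℕ → Pauli n) (off r : ℕ) :
    Outer r N →ₗ[ZMod 2] PauliB n N where
  toFun w := fun j =>
    (∑ ℓ : Fin r, (w j).1 ℓ • x (off + ℓ)) + (∑ ℓ : Fin r, (w j).2 ℓ • z (off + ℓ))
  map_add' := fun a b => by
    funext j
    simp [add_smul, Finset.sum_add_distrib]
    abel
  map_smul' := fun c a => by
    funext j
    simp [mul_smul, Finset.smul_sum, smul_add]

theorem symplF_comm {n : ℕ} (u v : Pauli n) : symplF n u v = symplF n v u := by
  simp only [symplF, sumForm, B0, LinearMap.mk₂_apply]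
  exact Finset.sum_congr rfl fun _ _ => add_comm _ _

theorem mem_perp_Sstab {n kk : ℕ} {S : Submodule (ZMod 2) (Pauli n)} {z : ℕ → Pauli n}
    {y : Pauli n} (hS : y ∈ perp (symplF n) S) (hz : ∀ t < kk, symplF n (z t) y = 0) :
    y ∈ perp (symplF n) (Sstab n S z kk) := by
  have hle : Sstab n S z kk ≤ LinearMap.ker ((symplF n).flip y) := by
    refine sup_le (fun s hs => hS s hs) (Submodule.span_le.2 ?_)
    rintro _ ⟨t, ht, rfl⟩
    exact hz t ht
  exact fun s hs => hle hs

theorem notMem_of_symplF_ne_zero {n : ℕ} {T : Submodule (ZMod 2) (Pauli n)} {y w : Pauli n}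
    (hy : y ∈ perp (symplF n) T) (h : symplF n y w ≠ 0) : w ∉ T := fun hw =>
  h ((symplF_comm y w).trans (hy w hw))

theorem phi_apply_mem {n N off r : ℕ} {x z : ℕ → Pauli n} {T : Submodule (ZMod 2) (Pauli n)}
    (hx : ∀ t, off ≤ t → t < off + r → x t ∈ T) (hz : ∀ t, off ≤ t → t < off + r → z t ∈ T)
    (w : Outer r N) (p : Fin N) : phi n N x z off r w p ∈ T := by
  refine T.add_mem (T.sum_mem fun ℓ _ => T.smul_mem _ (hx _ ?_ ?_))
    (T.sum_mem fun ℓ _ => T.smul_mem _ (hz _ ?_ ?_)) <;> omega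

theorem symplF_phi_apply {n N off r : ℕ} (x z : ℕ → Pauli n) (y : Pauli n) (w : Outer r N)
    (p : Fin N) :
    symplF n y (phi n N x z off r w p) =
      ∑ ℓ : Fin r, (w p).1 ℓ * symplF n y (x (off + ℓ)) +
        ∑ ℓ : Fin r, (w p).2 ℓ * symplF n y (z (off + ℓ)) := by
  simp [phi]

/-- An operator anticommuting with exactly one logical operator detects its coefficient. -/
theorem sum_mul_eq_of_eq_ite {r off : ℕ} (c : Fin r → ZMod 2) (ℓ₀ : Fin r) (f : ℕ → ZMod 2)
    (hf : ∀ ℓ : Fin r, f (off + ℓ) = if off + ℓ₀.val = off + ℓ.val then 1 else 0) :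
    ∑ ℓ : Fin r, c ℓ * f (off + ℓ) = c ℓ₀ := by
  simp only [hf, Nat.add_left_cancel_iff, Fin.val_inj]
  simp

section Logical

variable {n N κ : ℕ} {x z : ℕ → Pauli n}

theorem symplF_z_phi (hzz : ∀ s < κ, ∀ t < κ, symplF n (z s) (z t) = 0)
    (hxz : ∀ s < κ, ∀ t < κ, symplF n (x s) (z t) = if s = t then 1 else 0)
    {off r : ℕ} (hr : off + r ≤ κ) (w : Outer r N) (p : Fin N) (ℓ : Fin r) :
    symplF n (z (off + ℓ)) (phi n N x z off r w p) = (w p).1 ℓ := by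
  rw [symplF_phi_apply, sum_mul_eq_of_eq_ite _ ℓ (fun t => symplF n (z (off + ℓ)) (x t)),
    Finset.sum_eq_zero, add_zero]
  · intro ℓ' _
    rw [hzz _ (by omega) _ (by omega), mul_zero]
  · intro ℓ'
    rw [symplF_comm, hxz _ (by omega) _ (by omega)]
    simp only [eq_comm]

theorem symplF_x_phi (hxx : ∀ s < κ, ∀ t < κ, symplF n (x s) (x t) = 0)
    (hxz : ∀ s < κ, ∀ t < κ, symplF n (x s) (z t) = if s = t then 1 else 0)
    {off r : ℕ} (hr : off + r ≤ κ) (w : Outer r N) (p : Fin N) (ℓ : Fin r) :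
    symplF n (x (off + ℓ)) (phi n N x z off r w p) = (w p).2 ℓ := by
  rw [symplF_phi_apply, sum_mul_eq_of_eq_ite _ ℓ (fun t => symplF n (x (off + ℓ)) (z t)),
    Finset.sum_eq_zero, zero_add]
  · intro ℓ' _
    rw [hxx _ (by omega) _ (by omega), mul_zero]
  · exact fun ℓ' => hxz _ (by omega) _ (by omega)

theorem symplF_z_phi_of_notMem (hzz : ∀ s < κ, ∀ t < κ, symplF n (z s) (z t) = 0)
    (hxz : ∀ s < κ, ∀ t < κ, symplF n (x s) (z t) = if s = t then 1 else 0)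
    {off r t : ℕ} (hr : off + r ≤ κ) (ht : t < κ) (htr : t < off ∨ off + r ≤ t)
    (w : Outer r N) (p : Fin N) : symplF n (z t) (phi n N x z off r w p) = 0 := by
  rw [symplF_phi_apply, Finset.sum_eq_zero, Finset.sum_eq_zero, add_zero]
  · intro ℓ _
    rw [hzz _ (by omega) _ (by omega), mul_zero]
  · intro ℓ _
    rw [symplF_comm, hxz _ (by omega) _ (by omega), if_neg (by omega), mul_zero]

theorem symplF_x_phi_of_notMem (hxx : ∀ s < κ, ∀ t < κ, symplF n (x s) (x t) = 0)
    (hxz : ∀ s < κ, ∀ t < κ, symplF n (x s) (z t) = if s = t then 1 else 0)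
    {off r t : ℕ} (hr : off + r ≤ κ) (ht : t < κ) (htr : t < off ∨ off + r ≤ t)
    (w : Outer r N) (p : Fin N) : symplF n (x t) (phi n N x z off r w p) = 0 := by
  rw [symplF_phi_apply, Finset.sum_eq_zero, Finset.sum_eq_zero, add_zero]
  · intro ℓ _
    rw [hxz _ (by omega) _ (by omega), if_neg (by omega), mul_zero]
  · intro ℓ _
    rw [hxx _ (by omega) _ (by omega), mul_zero]

/-- If two elements of disjoint logical levels are not both trivial on a block, some logical
operator at or above the lower level anticommutes with their combined image there. -/
theorem exists_symplF_phi_add_ne_zero (hxx : ∀ s < κ, ∀ t < κ, symplF n (x s) (x t) = 0)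
    (hzz : ∀ s < κ, ∀ t < κ, symplF n (z s) (z t) = 0)
    (hxz : ∀ s < κ, ∀ t < κ, symplF n (x s) (z t) = if s = t then 1 else 0)
    {off r off' r' : ℕ} (hr : off + r ≤ off') (hr' : off' + r' ≤ κ)
    (u : Outer r' N) (v : Outer r N) (p : Fin N) (h : u p ≠ 0 ∨ v p ≠ 0) :
    ∃ t, off ≤ t ∧ t < κ ∧
      (symplF n (x t) ((phi n N x z off' r' u + phi n N x z off r v) p) ≠ 0 ∨
        symplF n (z t) ((phi n N x z off' r' u + phi n N x z off r v) p) ≠ 0) := by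
  have hrκ : off + r ≤ κ := by omega
  simp only [Pi.add_apply, map_add]
  have coord : ∀ {q : ℕ} {w : Outer q N}, w p ≠ 0 → ∃ ℓ, (w p).1 ℓ ≠ 0 ∨ (w p).2 ℓ ≠ 0 := by
    intro q w hw
    by_contra! h0
    exact hw (Prod.ext (funext fun ℓ => (h0 ℓ).1) (funext fun ℓ => (h0 ℓ).2))
  rcases h with h | h <;> obtain ⟨ℓ, hℓ⟩ := coord h
  · refine ⟨off' + ℓ, by omega, by omega, ?_⟩
    rw [symplF_x_phi hxx hxz hr', symplF_z_phi hzz hxz hr',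
      symplF_x_phi_of_notMem hxx hxz hrκ (by omega) (by omega),
      symplF_z_phi_of_notMem hzz hxz hrκ (by omega) (by omega), add_zero, add_zero]
    exact hℓ.symm
  · refine ⟨off + ℓ, by omega, by omega, ?_⟩
    rw [symplF_x_phi hxx hxz hrκ, symplF_z_phi hzz hxz hrκ,
      symplF_x_phi_of_notMem hxx hxz hr' (by omega) (by omega),
      symplF_z_phi_of_notMem hzz hxz hr' (by omega) (by omega), zero_add, zero_add]
    exact hℓ.symm

end Logical

/-- If every block on which `u` or `v` is nonzero has weight at least `δ`, then the total weight
is at least `δ` times the block weight of either one. -/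
theorem mul_max_wgt_le_swtB {n N δ : ℕ} {M M' : Type*} [Zero M] [DecidableEq M] [Zero M']
    [DecidableEq M'] (u : Fin N → M) (v : Fin N → M') (w : PauliB n N)
    (h : ∀ p, u p ≠ 0 ∨ v p ≠ 0 → δ ≤ wgt (w p)) : δ * max (wgt u) (wgt v) ≤ swtB w := by
  have key : ∀ s : Finset (Fin N), (∀ p ∈ s, δ ≤ wgt (w p)) → δ * s.card ≤ swtB w := by
    intro s hs
    calc δ * s.card = s.card • δ := by rw [smul_eq_mul, mul_comm]
      _ ≤ ∑ p ∈ s, wgt (w p) := Finset.card_nsmul_le_sum s _ δ hs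
      _ ≤ swtB w := Finset.sum_le_sum_of_subset (Finset.subset_univ s)
  rcases max_choice (wgt u) (wgt v) with hmax | hmax <;> rw [hmax]
  · exact key _ fun p hp => h p (Or.inl (Finset.mem_filter.1 hp).2)
  · exact key _ fun p hp => h p (Or.inr (Finset.mem_filter.1 hp).2)

/-- Case (iv) of the proof of Theorem 1: adding a stabilizer element coming from a
lower level `j < i` to a nontrivial level-`i` logical operator gives weight at least
`d_j · max(D_i, bwt v)`; in particular `≥ d_j D_j` when `A_j` is nondegenerate and
`v ≠ 0`, and `≥ d_j D_i` in all cases. -/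
theorem gcqc_case_iv
    (n N m : ℕ) (hm : 1 ≤ m)
    (k : ℕ → ℕ) (hk : ∀ i, 1 ≤ i → i ≤ m → k (i + 1) < k i) (hklast : k (m + 1) = 0)
    (hkn : k 1 ≤ n)
    (S : Submodule (ZMod 2) (Pauli n))
    (hSorth : S ≤ perp (symplF n) S)
    (hSdim : Module.finrank (ZMod 2) S = n - k 1)
    (x z : ℕ → Pauli n)
    (hxS : ∀ t < k 1, x t ∈ perp (symplF n) S)
    (hzS : ∀ t < k 1, z t ∈ perp (symplF n) S)
    (hxx : ∀ s < k 1, ∀ t < k 1, symplF n (x s) (x t) = 0)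
    (hzz : ∀ s < k 1, ∀ t < k 1, symplF n (z s) (z t) = 0)
    (hxz : ∀ s < k 1, ∀ t < k 1, symplF n (x s) (z t) = if s = t then 1 else 0)
    (hdual : perp (symplF n) S = S ⊔ Lspan n x z 0 (k 1))
    (hdisj : Disjoint S (Lspan n x z 0 (k 1)))
    (d : ℕ → ℕ)
    (hd : ∀ i, 1 ≤ i → i ≤ m + 1 → ∀ v ∈ perp (symplF n) (Sstab n S z (k 1 - k i)),
      v ∉ Sstab n S z (k 1 - k i) → d i ≤ wgt v)
    (K D : ℕ → ℕ) (hKN : ∀ i, 1 ≤ i → i ≤ m → K i ≤ N)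
    (SA : ∀ i : ℕ, Submodule (ZMod 2) (Outer (k i - k (i + 1)) N))
    (hSAorth : ∀ i, 1 ≤ i → i ≤ m → SA i ≤ perp (symplFO (k i - k (i + 1)) N) (SA i))
    (hSAdim : ∀ i, 1 ≤ i → i ≤ m →
      Module.finrank (ZMod 2) (SA i) = (k i - k (i + 1)) * (N - K i))
    (hSAdist : ∀ i, 1 ≤ i → i ≤ m → ∀ w ∈ perp (symplFO (k i - k (i + 1)) N) (SA i),
      w ∉ SA i → D i ≤ wgt w)
    (i j : ℕ) (h1j : 1 ≤ j) (hji : j < i) (him : i ≤ m)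
    (u : Outer (k i - k (i + 1)) N)
    (hu : u ∈ perp (symplFO (k i - k (i + 1)) N) (SA i)) (hu' : u ∉ SA i)
    (v : Outer (k j - k (j + 1)) N) (hv : v ∈ SA j) :
    d j * max (D i) (wgt v)
        ≤ swtB (phi n N x z (k 1 - k i) (k i - k (i + 1)) u
            + phi n N x z (k 1 - k j) (k j - k (j + 1)) v)
      ∧ ((∀ w ∈ SA j, w ≠ 0 → D j ≤ wgt w) → v ≠ 0 →
          d j * D j ≤ swtB (phi n N x z (k 1 - k i) (k i - k (i + 1)) u
            + phi n N x z (k 1 - k j) (k j - k (j + 1)) v))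
      ∧ d j * D i ≤ swtB (phi n N x z (k 1 - k i) (k i - k (i + 1)) u
            + phi n N x z (k 1 - k j) (k j - k (j + 1)) v) := by
  have hanti : ∀ a b, 1 ≤ a → a ≤ b → b ≤ m + 1 → k b ≤ k a := by
    intro a b ha hab
    induction b, hab using Nat.le_induction with
    | base => exact fun _ => le_rfl
    | succ b hab ih =>
      exact fun hb => (hk b (ha.trans hab) (by omega)).le.trans (ih (by omega))
  have hkj := hk j h1j (by omega)
  have hki := hk i (by omega) him
  have hkij := hanti (j + 1) i (by omega) hji (by omega)
  have hk1 := hanti 1 j le_rfl h1j (by omega)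
  have hoff : (k 1 - k j) + (k j - k (j + 1)) ≤ k 1 - k i := by omega
  have hoff' : (k 1 - k i) + (k i - k (i + 1)) ≤ k 1 := by omega
  have hxperp : ∀ t, k 1 - k j ≤ t → t < k 1 →
      x t ∈ perp (symplF n) (Sstab n S z (k 1 - k j)) := fun t ht ht1 =>
    mem_perp_Sstab (hxS t ht1) fun s hs => by
      rw [symplF_comm, hxz _ ht1 _ (by omega), if_neg (by omega)]
  have hzperp : ∀ t, k 1 - k j ≤ t → t < k 1 →
      z t ∈ perp (symplF n) (Sstab n S z (k 1 - k j)) := fun t ht ht1 =>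
    mem_perp_Sstab (hzS t ht1) fun s hs => hzz _ (by omega) _ ht1
  have hmain : d j * max (D i) (wgt v)
      ≤ swtB (phi n N x z (k 1 - k i) (k i - k (i + 1)) u
          + phi n N x z (k 1 - k j) (k j - k (j + 1)) v) := by
    refine (Nat.mul_le_mul_left _ (max_le_max_right _ (hSAdist i (by omega) him u hu hu'))).trans
      (mul_max_wgt_le_swtB u v _ fun p hp => hd j h1j (by omega) _ ?_ ?_)
    · refine Submodule.add_mem _ (phi_apply_mem ?_ ?_ u p) (phi_apply_mem ?_ ?_ v p)
      · exact fun t ht ht' => hxperp t (by omega) (by omega)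
      · exact fun t ht ht' => hzperp t (by omega) (by omega)
      · exact fun t ht ht' => hxperp t (by omega) (by omega)
      · exact fun t ht ht' => hzperp t (by omega) (by omega)
    · obtain ⟨t, ht, ht1, hne | hne⟩ :=
        exists_symplF_phi_add_ne_zero hxx hzz hxz hoff hoff' u v p hp
      · exact notMem_of_symplF_ne_zero (hxperp t ht ht1) hne
      · exact notMem_of_symplF_ne_zero (hzperp t ht ht1) hne
  refine ⟨hmain, fun hnd hv0 => ?_, ?_⟩
  · exact (Nat.mul_le_mul_left _ ((hnd v hv hv0).trans (le_max_right _ _))).trans hmain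
  · exact (Nat.mul_le_mul_left _ (le_max_left _ _)).trans hmain
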